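/- For every T > 0 there exists a constant C > 0, depending only on T, such that for all 0 ≤ s < t ≤ T and all R > 0: ∫_0^T ∫_ℝ ( ∫_{−R}^R ( p_{t−r}(x−y)·1_{r ≤ t} − p_{s−r}(x−y)·1_{r ≤ s} ) dx )² dy dr ≤ C·R·(t−s), where 1_{r ≤ t} denotes the indicator of r < t (and the corresponding heat kernel term is taken to be 0 when r ≥ t, and similarly for s). -/

import Mathlib

open MeasureTheory

/-- The one-dimensional heat kernel `p_t(x) = (2πt)^{-1/2} exp(-x²/(2t))`. -/
noncomputable def heatKernel (t x : ℝ) : ℝ :=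
  (Real.sqrt (2 * Real.pi * t))⁻¹ * Real.exp (-x ^ 2 / (2 * t))

lemma heatKernel_nonneg (a x : ℝ) : 0 ≤ heatKernel a x := by
  unfold heatKernel; positivity

lemma heatKernel_of_nonpos {a : ℝ} (ha : a ≤ 0) (x : ℝ) : heatKernel a x = 0 := by
  have : 2 * Real.pi * a ≤ 0 := mul_nonpos_of_nonneg_of_nonpos (by positivity) ha
  simp [heatKernel, Real.sqrt_eq_zero_of_nonpos this]

lemma measurable_heatKernel : Measurable fun p : ℝ × ℝ => heatKernel p.1 p.2 := by
  unfold heatKernel; fun_prop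

lemma continuous_heatKernel (a : ℝ) : Continuous (heatKernel a) := by
  unfold heatKernel; fun_prop

lemma heatKernel_neg (a x : ℝ) : heatKernel a (-x) = heatKernel a x := by
  simp [heatKernel]

lemma heatKernel_le (a x : ℝ) : heatKernel a x ≤ (Real.sqrt (2 * Real.pi * a))⁻¹ := by
  rcases le_or_gt a 0 with ha | ha
  · rw [heatKernel_of_nonpos ha]; positivity
  · unfold heatKernel
    refine mul_le_of_le_one_right (by positivity) (Real.exp_le_one_iff.2 ?_)
    rw [neg_div]
    exact neg_nonpos.2 (by positivity)

lemma heatKernel_sub_eq_gaussianPDFReal {a : ℝ} (ha : 0 < a) (m y : ℝ) :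
    heatKernel a (y - m) = ProbabilityTheory.gaussianPDFReal m ⟨a, ha.le⟩ y := rfl

lemma integrable_heatKernel_sub (a m : ℝ) : Integrable fun y => heatKernel a (y - m) := by
  rcases le_or_gt a 0 with ha | ha
  · simp [heatKernel_of_nonpos ha]
  · simpa only [heatKernel_sub_eq_gaussianPDFReal ha] using
      ProbabilityTheory.integrable_gaussianPDFReal m ⟨a, ha.le⟩

lemma integral_heatKernel_sub {a : ℝ} (ha : 0 < a) (m : ℝ) :
    ∫ y, heatKernel a (y - m) = 1 := by
  simp only [heatKernel_sub_eq_gaussianPDFReal ha]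
  exact ProbabilityTheory.integral_gaussianPDFReal_eq_one m
    (fun h => ha.ne' (congrArg NNReal.toReal h))

lemma integral_heatKernel_sub_le_one (a m : ℝ) : ∫ y, heatKernel a (y - m) ≤ 1 := by
  rcases le_or_gt a 0 with ha | ha
  · simp [heatKernel_of_nonpos ha]
  · exact (integral_heatKernel_sub ha m).le

/-- Completing the square in a product of two heat kernels. -/
lemma heatKernel_mul_heatKernel {a b : ℝ} (ha : 0 < a) (hb : 0 < b) (x z y : ℝ) :
    heatKernel a (x - y) * heatKernel b (z - y) =
      heatKernel (a + b) (x - z) *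
        heatKernel (a * b / (a + b)) (y - (b * x + a * z) / (a + b)) := by
  have hab : 0 < a + b := add_pos ha hb
  unfold heatKernel
  rw [mul_mul_mul_comm, mul_mul_mul_comm (Real.sqrt (2 * Real.pi * (a + b)))⁻¹, ← Real.exp_add,
    ← Real.exp_add, ← mul_inv, ← mul_inv, ← Real.sqrt_mul (by positivity),
    ← Real.sqrt_mul (by positivity)]
  congr 2
  · congr 1
    field_simp
  · field_simp
    ring

/-- The mass that the heat kernel of time `a` started at `y` gives to `[-R, R]`. -/
noncomputable def heatMass (R a y : ℝ) : ℝ := ∫ x in Set.Icc (-R) R, heatKernel a (x - y)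

/-- The heat energy `⟨P_a 1_{[-R, R]}, 1_{[-R, R]}⟩`. -/
noncomputable def heatEnergy (R a : ℝ) : ℝ :=
  ∫ q : ℝ × ℝ, heatKernel a (q.1 - q.2)
    ∂((volume.restrict (Set.Icc (-R) R)).prod (volume.restrict (Set.Icc (-R) R)))

lemma heatMass_of_nonpos (R : ℝ) {a : ℝ} (ha : a ≤ 0) (y : ℝ) : heatMass R a y = 0 := by
  simp [heatMass, heatKernel_of_nonpos ha]

lemma heatEnergy_of_nonpos (R : ℝ) {a : ℝ} (ha : a ≤ 0) : heatEnergy R a = 0 := by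
  simp [heatEnergy, heatKernel_of_nonpos ha]

lemma heatEnergy_nonneg (R a : ℝ) : 0 ≤ heatEnergy R a :=
  integral_nonneg fun _ => heatKernel_nonneg _ _

lemma integrable_heatKernel_sub_prod (R a : ℝ) :
    Integrable (fun q : ℝ × ℝ => heatKernel a (q.1 - q.2))
      ((volume.restrict (Set.Icc (-R) R)).prod (volume.restrict (Set.Icc (-R) R))) := by
  refine Integrable.of_bound (C := (Real.sqrt (2 * Real.pi * a))⁻¹)
    ((continuous_heatKernel a).comp (by fun_prop)).aestronglyMeasurable (ae_of_all _ fun q => ?_)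
  rw [Real.norm_of_nonneg (heatKernel_nonneg _ _)]
  exact heatKernel_le _ _

lemma heatEnergy_le {R : ℝ} (hR : 0 < R) (a : ℝ) : heatEnergy R a ≤ 2 * R := by
  unfold heatEnergy
  rw [integral_prod _ (integrable_heatKernel_sub_prod R a)]
  calc ∫ x in Set.Icc (-R) R, ∫ z in Set.Icc (-R) R, heatKernel a (x - z)
      ≤ ∫ _ in Set.Icc (-R) R, (1 : ℝ) := by
        refine integral_mono (integrable_heatKernel_sub_prod R a).integral_prod_left
          (integrable_const _) fun x => ?_
        have hsymm : ∀ z, heatKernel a (x - z) = heatKernel a (z - x) := fun z => by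
          rw [← heatKernel_neg, neg_sub]
        simp only [hsymm]
        exact (setIntegral_le_integral (integrable_heatKernel_sub a x)
          (ae_of_all _ fun _ => heatKernel_nonneg _ _)).trans (integral_heatKernel_sub_le_one a x)
    _ = 2 * R := by
        simp only [integral_const, smul_eq_mul, mul_one, measureReal_restrict_apply_univ,
          Real.volume_real_Icc]
        rw [max_eq_left (by linarith)]
        ring

lemma measurable_heatEnergy (R : ℝ) : Measurable (heatEnergy R) := by
  have h : Measurable fun p : ℝ × (ℝ × ℝ) => heatKernel p.1 (p.2.1 - p.2.2) :=
    measurable_heatKernel.comp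
      (measurable_fst.prodMk (measurable_snd.fst.sub measurable_snd.snd))
  exact h.stronglyMeasurable.integral_prod_right.measurable

lemma intervalIntegrable_heatEnergy_comp {R : ℝ} (hR : 0 < R) {f : ℝ → ℝ} (hf : Measurable f)
    (u v : ℝ) : IntervalIntegrable (fun r => heatEnergy R (f r)) volume u v := by
  refine (intervalIntegrable_const (c := 2 * R)).mono_fun
    ((measurable_heatEnergy R).comp hf).aestronglyMeasurable (ae_of_all _ fun r => ?_)
  simp only
  rw [Real.norm_of_nonneg (heatEnergy_nonneg _ _), Real.norm_of_nonneg (by positivity)]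
  exact heatEnergy_le hR _

lemma heatKernel_mul_integrable_prod (R : ℝ) {a b : ℝ} (ha : 0 < a) (hb : 0 < b) :
    Integrable (fun p : ℝ × (ℝ × ℝ) => heatKernel a (p.2.1 - p.1) * heatKernel b (p.2.2 - p.1))
      (volume.prod
        ((volume.restrict (Set.Icc (-R) R)).prod (volume.restrict (Set.Icc (-R) R)))) := by
  have hab : 0 < a * b / (a + b) := by positivity
  rw [integrable_prod_iff']
  · refine ⟨ae_of_all _ fun q => ?_, ?_⟩
    · simp only [heatKernel_mul_heatKernel ha hb]
      exact (integrable_heatKernel_sub _ _).const_mul _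
    · simp only [Real.norm_of_nonneg (mul_nonneg (heatKernel_nonneg _ _) (heatKernel_nonneg _ _)),
        heatKernel_mul_heatKernel ha hb, integral_const_mul, integral_heatKernel_sub hab, mul_one]
      exact integrable_heatKernel_sub_prod R (a + b)
  · exact (((continuous_heatKernel a).comp (by fun_prop)).mul
      ((continuous_heatKernel b).comp (by fun_prop))).aestronglyMeasurable

lemma heatMass_mul_heatMass (R a b y : ℝ) :
    heatMass R a y * heatMass R b y =
      ∫ q : ℝ × ℝ, heatKernel a (q.1 - y) * heatKernel b (q.2 - y)
        ∂((volume.restrict (Set.Icc (-R) R)).prod (volume.restrict (Set.Icc (-R) R))) :=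
  (integral_prod_mul (fun x => heatKernel a (x - y)) fun x => heatKernel b (x - y)).symm

lemma integrable_heatMass_mul (R a b : ℝ) :
    Integrable fun y => heatMass R a y * heatMass R b y := by
  rcases le_or_gt a 0 with ha | ha
  · simp [heatMass_of_nonpos R ha]
  rcases le_or_gt b 0 with hb | hb
  · simp [heatMass_of_nonpos R hb]
  simp only [heatMass_mul_heatMass]
  exact (heatKernel_mul_integrable_prod R ha hb).integral_prod_left

lemma integral_heatMass_mul (R : ℝ) {a b : ℝ} (ha : 0 < a) (hb : 0 < b) :
    ∫ y, heatMass R a y * heatMass R b y = heatEnergy R (a + b) := by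
  have hab : 0 < a * b / (a + b) := by positivity
  simp only [heatMass_mul_heatMass]
  rw [integral_integral_swap (heatKernel_mul_integrable_prod R ha hb)]
  simp only [heatKernel_mul_heatKernel ha hb, integral_const_mul, integral_heatKernel_sub hab,
    mul_one, heatEnergy]

lemma integral_heatMass_mul_self (R a : ℝ) :
    ∫ y, heatMass R a y * heatMass R a y = heatEnergy R (2 * a) := by
  rcases le_or_gt a 0 with ha | ha
  · simp [heatMass_of_nonpos R ha, heatEnergy_of_nonpos R (by linarith : 2 * a ≤ 0)]
  · rw [integral_heatMass_mul R ha ha, two_mul]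

lemma integral_heatMass_sub_sq (R a b : ℝ) :
    ∫ y, (heatMass R a y - heatMass R b y) ^ 2 =
      heatEnergy R (2 * a) + heatEnergy R (2 * b) -
        2 * ∫ y, heatMass R a y * heatMass R b y := by
  have haa := integrable_heatMass_mul R a a
  have hbb := integrable_heatMass_mul R b b
  have hab := integrable_heatMass_mul R a b
  have hexp : ∀ y, (heatMass R a y - heatMass R b y) ^ 2 =
      heatMass R a y * heatMass R a y + heatMass R b y * heatMass R b y -
        2 * (heatMass R a y * heatMass R b y) := fun y => by ring
  simp only [hexp]
  rw [integral_sub (by exact haa.add hbb) (hab.const_mul 2), integral_add haa hbb,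
    integral_const_mul, integral_heatMass_mul_self, integral_heatMass_mul_self]

lemma setIntegral_heatKernel_sub_eq (R s t r y : ℝ) :
    (∫ x in Set.Icc (-R) R,
      ((if r < t then heatKernel (t - r) (x - y) else 0) -
        (if r < s then heatKernel (s - r) (x - y) else 0))) =
      heatMass R (t - r) y - heatMass R (s - r) y := by
  have hite : ∀ c x : ℝ, (if r < c then heatKernel (c - r) (x - y) else 0) =
      heatKernel (c - r) (x - y) := fun c x => by
    split_ifs with h
    · rfl
    · exact (heatKernel_of_nonpos (by linarith) _).symm
  simp only [hite]
  exact integral_sub (integrable_heatKernel_sub _ _).integrableOn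
    (integrable_heatKernel_sub _ _).integrableOn

lemma intervalIntegral_heatEnergy_two_mul {R c T : ℝ} (hR : 0 < R) (hc : c ≤ T) :
    ∫ r in (0 : ℝ)..T, heatEnergy R (2 * (c - r)) = (∫ a in (0 : ℝ)..2 * c, heatEnergy R a) / 2 := by
  have henergy : ∀ u v, IntervalIntegrable (heatEnergy R) volume u v :=
    intervalIntegrable_heatEnergy_comp hR measurable_id
  have hzero : ∫ a in (2 * c - 2 * T)..0, heatEnergy R a = 0 := by
    refine intervalIntegral.integral_zero_ae (ae_of_all _ fun a ha => ?_)
    rw [Set.uIoc_of_le (by linarith)] at ha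
    exact heatEnergy_of_nonpos R ha.2
  simp only [mul_sub]
  rw [intervalIntegral.integral_comp_sub_mul (heatEnergy R) two_ne_zero, mul_zero, sub_zero,
    ← intervalIntegral.integral_add_adjacent_intervals (henergy _ 0) (henergy 0 _), hzero, smul_eq_mul]
  ring

lemma intervalIntegral_heatEnergy_le {R u v : ℝ} (hR : 0 < R) (huv : u ≤ v) :
    ∫ a in u..v, heatEnergy R a ≤ 2 * R * (v - u) := by
  have h := intervalIntegral.integral_mono_on huv
    (intervalIntegrable_heatEnergy_comp hR measurable_id u v)
    (intervalIntegrable_const (c := 2 * R)) fun a _ => heatEnergy_le hR a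
  rwa [intervalIntegral.integral_const, smul_eq_mul, mul_comm] at h

lemma intervalIntegral_integral_heatMass_mul {R s t T : ℝ} (hR : 0 < R) (hs : 0 ≤ s)
    (hst : s < t) (hsT : s ≤ T) :
    IntervalIntegrable (fun r => ∫ y, heatMass R (t - r) y * heatMass R (s - r) y) volume 0 T ∧
      ∫ r in (0 : ℝ)..T, ∫ y, heatMass R (t - r) y * heatMass R (s - r) y =
        (∫ a in (t - s)..(t + s), heatEnergy R a) / 2 := by
  have henergy := intervalIntegrable_heatEnergy_comp hR (f := fun r => t + s - 2 * r)
    (by fun_prop) 0 s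
  have hbefore : Set.EqOn (fun r => heatEnergy R (t + s - 2 * r))
      (fun r => ∫ y, heatMass R (t - r) y * heatMass R (s - r) y) (Set.uIoo 0 s) := by
    intro r hr
    rw [Set.uIoo_of_le hs] at hr
    have hrs := hr.2
    simp only
    rw [integral_heatMass_mul R (by linarith) (by linarith)]
    congr 1
    ring
  have hafter : Set.EqOn (fun _ => (0 : ℝ))
      (fun r => ∫ y, heatMass R (t - r) y * heatMass R (s - r) y) (Set.uIoo s T) := by
    intro r hr
    rw [Set.uIoo_of_le hsT] at hr
    simp [heatMass_of_nonpos R (by linarith [hr.1] : s - r ≤ 0)]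
  have hbefore_int := henergy.congr_uIoo hbefore
  have hafter_int := (intervalIntegrable_const (μ := volume) (c := (0 : ℝ))).congr_uIoo hafter
  refine ⟨hbefore_int.trans hafter_int, ?_⟩
  rw [← intervalIntegral.integral_add_adjacent_intervals hbefore_int hafter_int,
    ← intervalIntegral.integral_congr_uIoo hbefore, ← intervalIntegral.integral_congr_uIoo hafter,
    intervalIntegral.integral_comp_sub_mul (heatEnergy R) two_ne_zero]
  rw [mul_zero, sub_zero, show t + s - 2 * s = t - s by ring, intervalIntegral.integral_zero,
    smul_eq_mul]
  ring

/-- The key deterministic estimate (eq:needed) in the proof of tightness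
(Proposition 4.1): for `0 ≤ s < t ≤ T` and `R > 0`,
`∫_0^T ∫_ℝ ( ∫_{-R}^R ( p_{t-r}(x-y) 1_{r<t} - p_{s-r}(x-y) 1_{r<s} ) dx )² dy dr
  ≤ C R (t-s)`. -/
theorem tightness_estimate (T : ℝ) (hT : 0 < T) :
    ∃ C : ℝ, 0 < C ∧ ∀ s t R : ℝ, 0 ≤ s → s < t → t ≤ T → 0 < R →
      (∫ r in Set.Ioc (0 : ℝ) T, ∫ y : ℝ,
        (∫ x in Set.Icc (-R) R,
          ((if r < t then heatKernel (t - r) (x - y) else 0) -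
           (if r < s then heatKernel (s - r) (x - y) else 0))) ^ 2)
        ≤ C * R * (t - s) := by
  refine ⟨3, by norm_num, fun s t R hs hst htT hR => ?_⟩
  have henergy : ∀ u v, IntervalIntegrable (heatEnergy R) volume u v :=
    intervalIntegrable_heatEnergy_comp hR measurable_id
  obtain ⟨hcross_int, hcross⟩ :=
    intervalIntegral_integral_heatMass_mul hR hs hst (hst.le.trans htT)
  simp only [setIntegral_heatKernel_sub_eq, integral_heatMass_sub_sq]
  have ht := intervalIntegrable_heatEnergy_comp hR (f := fun r => 2 * (t - r)) (by fun_prop) 0 T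
  have hs' := intervalIntegrable_heatEnergy_comp hR (f := fun r => 2 * (s - r)) (by fun_prop) 0 T
  rw [← intervalIntegral.integral_of_le hT.le,
    intervalIntegral.integral_sub (ht.add hs') (hcross_int.const_mul 2),
    intervalIntegral.integral_add ht hs', intervalIntegral.integral_const_mul, hcross,
    intervalIntegral_heatEnergy_two_mul hR htT,
    intervalIntegral_heatEnergy_two_mul hR (hst.le.trans htT)]
  have h₁ := intervalIntegral.integral_add_adjacent_intervals (henergy 0 (t - s)) (henergy (t - s) (t + s))
  have h₂ := intervalIntegral.integral_add_adjacent_intervals (henergy 0 (t + s)) (henergy (t + s) (2 * t))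
  have h₃ := intervalIntegral.integral_add_adjacent_intervals (henergy 0 (2 * s)) (henergy (2 * s) (t + s))
  have h₄ := intervalIntegral_heatEnergy_le hR (show (0 : ℝ) ≤ t - s by linarith)
  have h₅ := intervalIntegral_heatEnergy_le hR (show t + s ≤ 2 * t by linarith)
  have h₆ : 0 ≤ ∫ a in (2 * s)..(t + s), heatEnergy R a :=
    intervalIntegral.integral_nonneg (by linarith) fun a _ => heatEnergy_nonneg R a
  linarith
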